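/- arXiv:1108.4840 — 2 statements merged into one kernel-verified Lean document; each statement's English description precedes it below -/
import Mathlib

section
/- Let p be an odd prime and let P, Q be integers with p ∤ PQ(P² − 4Q) and with Q a quadratic residue modulo p (Legendre symbol (Q|p) = 1). Then, with congruences interpreted in ℤ/pℤ: (i) if (4Q − P²|p) = −1, then ∑_{k=0}^{⌊p/4⌋} C(4k,2k)·(P²/(64Q))^k ≡ 0 (mod p); (ii) if (P² − 4Q|p) = −1, then ∑_{k=0}^{⌊p/4⌋} C(4k,2k)·(Q/(4P²))^k ≡ 0 (mod p). -/
theorem Finset.sum_range_two_mul_eq {M : Type*} [AddCommMonoid M] (f : ℕ → M) (m : ℕ) :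
    ∑ j ∈ Finset.range (2 * m), f j = ∑ k ∈ Finset.range m, (f (2 * k) + f (2 * k + 1)) := by
  induction m with
  | zero => simp
  | succ m ih =>
    rw [Nat.mul_succ, Finset.sum_range_succ, Finset.sum_range_succ, ih, Finset.sum_range_succ,
      add_assoc]

theorem ZMod.centralBinom_eq_choose_mul_pow {p : ℕ} [Fact p.Prime] (hp : p ≠ 2) {j : ℕ}
    (hj : j < p) : (j.centralBinom : ZMod p) = ((p / 2).choose j : ZMod p) * (-4) ^ j := by
  have hodd : p % 2 = 1 := (Fact.out : p.Prime).eq_two_or_odd.resolve_left hp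
  have hhalf : 2 * ((p / 2 : ℕ) : ZMod p) + 1 = 0 := by
    have h : 2 * (p / 2) + 1 = p := by omega
    have h' := congrArg (Nat.cast : ℕ → ZMod p) h
    push_cast at h'
    simpa using h'
  induction j with
  | zero => simp
  | succ j ih =>
    have hj0 : ((j + 1 : ℕ) : ZMod p) ≠ 0 := by
      rw [Ne, ZMod.natCast_eq_zero_iff]
      exact Nat.not_dvd_of_pos_of_lt j.succ_pos hj
    have h₁ := congrArg (Nat.cast : ℕ → ZMod p) (Nat.succ_mul_centralBinom_succ j)
    have h₂ : (((p / 2).choose (j + 1) : ℕ) : ZMod p) * ((j + 1 : ℕ) : ZMod p) =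
        ((p / 2).choose j : ZMod p) * (((p / 2 : ℕ) : ZMod p) - j) := by
      rcases le_or_gt j (p / 2) with hle | hlt
      · rw [← Nat.cast_sub hle]
        exact_mod_cast congrArg (Nat.cast : ℕ → ZMod p) (Nat.choose_succ_right_eq (p / 2) j)
      · rw [Nat.choose_eq_zero_of_lt hlt, Nat.choose_eq_zero_of_lt (by omega)]
        simp
    apply mul_left_cancel₀ hj0
    push_cast at h₁ h₂ ⊢
    rw [ih (by omega)] at h₁
    rw [h₁, pow_succ]
    linear_combination (4 * (-4) ^ j : ZMod p) * h₂ +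
      (2 * ((p / 2).choose j : ZMod p) * (-4) ^ j) * hhalf

theorem ZMod.two_mul_sum_choose_four_mul_two_mul {p : ℕ} [Fact p.Prime] (hp : p ≠ 2)
    (y : ZMod p) :
    2 * ∑ k ∈ Finset.range (p / 4 + 1), ((4 * k).choose (2 * k) : ZMod p) * (y ^ 2) ^ k =
      (1 - 4 * y) ^ (p / 2) + (1 + 4 * y) ^ (p / 2) := by
  have hodd : p % 2 = 1 := (Fact.out : p.Prime).eq_two_or_odd.resolve_left hp
  have expand (z : ZMod p) : (1 + z) ^ (p / 2) =
      ∑ j ∈ Finset.range (2 * (p / 4 + 1)), z ^ j * ((p / 2).choose j : ZMod p) := by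
    rw [add_comm, add_pow]
    simp only [one_pow, mul_one]
    apply Finset.sum_subset
    · intro j hj
      rw [Finset.mem_range] at hj ⊢
      omega
    · intro j _ hj
      rw [Finset.mem_range] at hj
      rw [Nat.choose_eq_zero_of_lt (by omega), Nat.cast_zero, mul_zero]
  rw [sub_eq_add_neg, expand, expand, ← Finset.sum_add_distrib, Finset.sum_range_two_mul_eq,
    Finset.mul_sum]
  refine Finset.sum_congr rfl fun k hk => ?_
  rw [Finset.mem_range] at hk
  have h := ZMod.centralBinom_eq_choose_mul_pow hp (j := 2 * k) (by omega)
  rw [Nat.centralBinom, ← mul_assoc] at h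
  norm_num only at h
  rw [h, (even_two_mul k).neg_pow, (even_two_mul k).neg_pow, (odd_two_mul_add_one k).neg_pow,
    mul_pow, ← pow_mul]
  ring

theorem ZMod.pow_half_add_pow_half_eq_zero {p : ℕ} [Fact p.Prime] {a b : ZMod p}
    (h : (a * b) ^ (p / 2) = -1) : a ^ (p / 2) + b ^ (p / 2) = 0 := by
  rw [mul_pow] at h
  have ha : a ≠ 0 := by
    rintro rfl
    have hpos : p / 2 ≠ 0 := by
      have := (Fact.out : p.Prime).two_le
      omega
    simp [hpos] at h
  rcases ZMod.pow_div_two_eq_neg_one_or_one p ha with h' | h' <;> rw [h'] at h ⊢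
  · linear_combination h
  · linear_combination -h

theorem ZMod.sum_choose_four_mul_two_mul_eq_zero {p : ℕ} [Fact p.Prime] (hp : p ≠ 2)
    {c y : ZMod p} (hc : c ≠ 0) {d : ℤ} (hd : legendreSym p d = -1)
    (hdy : (d : ZMod p) = c ^ 2 * (1 - (4 * y) ^ 2)) :
    ∑ k ∈ Finset.range (p / 4 + 1), ((4 * k).choose (2 * k) : ZMod p) * (y ^ 2) ^ k = 0 := by
  have hodd : p % 2 = 1 := (Fact.out : p.Prime).eq_two_or_odd.resolve_left hp
  have h2 : (2 : ZMod p) ≠ 0 := Ring.two_ne_zero (by rwa [ZMod.ringChar_zmod_n])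
  have hd' := legendreSym.eq_pow p d
  have hcp : (c ^ 2) ^ (p / 2) = 1 := by
    rw [← pow_mul, show 2 * (p / 2) = p - 1 by omega, ZMod.pow_card_sub_one_eq_one hc]
  rw [hd, hdy, mul_pow, hcp, one_mul] at hd'
  refine (mul_eq_zero.mp ?_).resolve_left h2
  rw [ZMod.two_mul_sum_choose_four_mul_two_mul hp]
  apply ZMod.pow_half_add_pow_half_eq_zero
  rw [show (1 - 4 * y) * (1 + 4 * y) = 1 - (4 * y) ^ 2 by ring, ← hd']
  simp


theorem stmt3 (p : ℕ) [Fact p.Prime] (hp : p ≠ 2) (P Q : ℤ)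
    (h : ¬ (p : ℤ) ∣ P * Q * (P ^ 2 - 4 * Q)) (hQ : legendreSym p Q = 1) :
    (legendreSym p (4 * Q - P ^ 2) = -1 →
      (∑ k ∈ Finset.range (p / 4 + 1),
          (Nat.choose (4 * k) (2 * k) : ZMod p) *
            ((P : ZMod p) ^ 2 / (64 * (Q : ZMod p))) ^ k) = 0) ∧
    (legendreSym p (P ^ 2 - 4 * Q) = -1 →
      (∑ k ∈ Finset.range (p / 4 + 1),
          (Nat.choose (4 * k) (2 * k) : ZMod p) *
            ((Q : ZMod p) / (4 * (P : ZMod p) ^ 2)) ^ k) = 0) := by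
  have h2 : (2 : ZMod p) ≠ 0 := Ring.two_ne_zero (by rwa [ZMod.ringChar_zmod_n])
  have h64 : (64 : ZMod p) ≠ 0 := by
    rw [show (64 : ZMod p) = 2 ^ 6 by norm_num]
    exact pow_ne_zero 6 h2
  have h4 : (4 : ZMod p) ≠ 0 := by
    rw [show (4 : ZMod p) = 2 ^ 2 by norm_num]
    exact pow_ne_zero 2 h2
  have h8 : (8 : ZMod p) ≠ 0 := by
    rw [show (8 : ZMod p) = 2 ^ 3 by norm_num]
    exact pow_ne_zero 3 h2
  rw [← ZMod.intCast_zmod_eq_zero_iff_dvd] at h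
  push_cast at h
  obtain ⟨hPQ, -⟩ := mul_ne_zero_iff.mp h
  obtain ⟨hP0, hQ0⟩ := mul_ne_zero_iff.mp hPQ
  obtain ⟨q, hq⟩ := (legendreSym.eq_one_iff p hQ0).mp hQ
  have hq0 : q ≠ 0 := by
    rintro rfl
    simp [hq] at hQ0
  refine ⟨fun hd => ?_, fun hd => ?_⟩
  · rw [show (P : ZMod p) ^ 2 / (64 * (Q : ZMod p)) = (P / (8 * q)) ^ 2 by
      rw [hq]; field_simp; norm_num]
    apply ZMod.sum_choose_four_mul_two_mul_eq_zero hp (mul_ne_zero h2 hq0) hd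
    push_cast
    rw [hq]
    field_simp
    ring
  · rw [show (Q : ZMod p) / (4 * (P : ZMod p) ^ 2) = (q / (2 * P)) ^ 2 by
      rw [hq]; field_simp; norm_num]
    apply ZMod.sum_choose_four_mul_two_mul_eq_zero hp hP0 hd
    push_cast
    rw [hq]
    field_simp
    ring
end

section
/- Let p > 5 be a prime. Then, with congruences interpreted in ℤ/pℤ: (i) ∑_{k=0}^{⌊p/4⌋} C(4k,2k)/(−64)^k ≡ (−1)^{⌊(p+5)/10⌋}·5^{⌊p/4⌋} (mod p) if p ≡ 1,3,7,9 (mod 20); ≡ 2·(−1)^{⌊(p+5)/10⌋}·5^{(p−3)/4} (mod p) if p ≡ 11,19 (mod 20); ≡ 0 (mod p) if p ≡ 13,17 (mod 20). (ii) ∑_{k=0}^{⌊p/4⌋} C(4k,2k)/(−4)^k ≡ (−1)^{⌊(p+5)/10⌋}·5^{⌊p/4⌋} (mod p) if p ≡ 1,9,11,19 (mod 20); ≡ −2·(−1)^{⌊(p+5)/10⌋}·5^{(p−3)/4} (mod p) if p ≡ 3,7 (mod 20); ≡ 0 (mod p) if p ≡ 13,17 (mod 20). -/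
section

variable {K : Type*} [Field K]

theorem sum_range_two_mul {M : Type*} [AddCommMonoid M] (f : ℕ → M) (N : ℕ) :
    ∑ j ∈ Finset.range (2 * N), f j = ∑ k ∈ Finset.range N, (f (2 * k) + f (2 * k + 1)) := by
  induction N with
  | zero => simp
  | succ N ih =>
    rw [show 2 * (N + 1) = 2 * N + 1 + 1 by ring, Finset.sum_range_succ, Finset.sum_range_succ, ih,
      Finset.sum_range_succ, add_assoc]

/-- Twice the even part of the binomial expansion of `(1 + y) ^ n`. -/
theorem two_mul_sum_choose_even (y : K) (n : ℕ) :
    2 * ∑ k ∈ Finset.range (n / 2 + 1), (n.choose (2 * k) : K) * y ^ (2 * k) =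
      (1 + y) ^ n + (1 - y) ^ n := by
  have expand (z : K) : (1 + z) ^ n =
      ∑ j ∈ Finset.range (2 * (n / 2 + 1)), z ^ j * (n.choose j : K) := by
    rw [add_comm, add_pow]
    simp only [one_pow, mul_one]
    apply Finset.sum_subset
    · intro j
      simp only [Finset.mem_range]
      omega
    · intro j _ hj
      rw [Nat.choose_eq_zero_of_lt (by simpa using hj)]
      simp
  rw [sub_eq_add_neg, expand y, expand (-y), ← Finset.sum_add_distrib, sum_range_two_mul,
    Finset.mul_sum]
  refine Finset.sum_congr rfl fun k _ => ?_
  simp only [pow_succ, pow_mul]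
  ring

variable {p : ℕ}

theorem centralBinom_cast_eq [CharP K p] {n : ℕ} (hpn : p = 2 * n + 1) {k : ℕ} (hk : k ≤ n) :
    (k.centralBinom : K) = (-4) ^ k * (n.choose k : K) := by
  have hn : 2 * (n : K) + 1 = 0 := by
    have := CharP.cast_eq_zero K p
    rw [hpn] at this
    exact_mod_cast this
  induction k with
  | zero => simp
  | succ k ih =>
    have hk0 : ((k : K) + 1) ≠ 0 := by
      have : ((k + 1 : ℕ) : K) ≠ 0 := by
        rw [Ne, CharP.cast_eq_zero_iff K p]
        intro h
        have := Nat.le_of_dvd (Nat.succ_pos k) h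
        omega
      exact_mod_cast this
    have h1 := congrArg (Nat.cast : ℕ → K) (Nat.succ_mul_centralBinom_succ k)
    have h2 := congrArg (Nat.cast : ℕ → K) (Nat.choose_succ_right_eq n k)
    push_cast [Nat.cast_sub (show k ≤ n by omega)] at h1 h2
    rw [ih (by omega)] at h1
    apply mul_left_cancel₀ hk0
    rw [h1, pow_succ]
    linear_combination 4 * (-4) ^ k * h2 + (-4) ^ k * (n.choose k : K) * 2 * hn

theorem two_mul_sum_choose_div_pow [CharP K p] {n : ℕ} (hpn : p = 2 * n + 1) {m y : K}
    (hm : m ≠ 0) (hy : m * y ^ 2 = 16) :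
    2 * ∑ k ∈ Finset.range (p / 4 + 1), (Nat.choose (4 * k) (2 * k) : K) / m ^ k =
      (1 + y) ^ n + (1 - y) ^ n := by
  rw [← two_mul_sum_choose_even, show p / 4 = n / 2 by omega]
  congr 1
  refine Finset.sum_congr rfl fun k hk => ?_
  have h := centralBinom_cast_eq (K := K) hpn (k := 2 * k)
    (by have := Finset.mem_range.mp hk; omega)
  rw [Nat.centralBinom, show 2 * (2 * k) = 4 * k by ring] at h
  rw [h, div_eq_iff (pow_ne_zero _ hm), pow_mul, pow_mul, mul_assoc, ← mul_pow, mul_comm (y ^ 2) m,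
    hy]
  norm_num
  ring

variable [CharP K p]

theorem two_ne_zero_of_charP (hp : 5 < p) : (2 : K) ≠ 0 := by
  have : ((2 : ℕ) : K) ≠ 0 := by
    rw [Ne, CharP.cast_eq_zero_iff K p]
    exact fun h => by have := Nat.le_of_dvd (by norm_num) h; omega
  exact_mod_cast this

theorem five_ne_zero_of_charP (hp : 5 < p) : (5 : K) ≠ 0 := by
  have : ((5 : ℕ) : K) ≠ 0 := by
    rw [Ne, CharP.cast_eq_zero_iff K p]
    exact fun h => by have := Nat.le_of_dvd (by norm_num) h; omega
  exact_mod_cast this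

theorem half_one_add_ne_zero (hp : 5 < p) {s : K} (hs : s ^ 2 = 5) : (1 + s) / 2 ≠ 0 := by
  have h2 := two_ne_zero_of_charP (K := K) hp
  refine div_ne_zero (fun h => mul_ne_zero h2 h2 ?_) h2
  linear_combination (s - 1) * h - hs

theorem one_add_two_mul_add_ne_zero (hp : 5 < p) {i s : K} (hi : i ^ 2 = -1) (hs : s ^ 2 = 5) :
    1 + 2 * i + s ≠ 0 := by
  have h2 := two_ne_zero_of_charP (K := K) hp
  have h5 := five_ne_zero_of_charP (K := K) hp
  intro h
  have h1 : (2 * 5) * (1 + s) = 0 := by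
    linear_combination (1 - 2 * i) * ((1 + 2 * i + s) * h - hs - 4 * hi) + 8 * (1 + s) * hi
  exact mul_ne_zero (mul_ne_zero h2 h5) (div_ne_zero_iff.mp (half_one_add_ne_zero hp hs)).1 h1

theorem one_add_ne_zero_of_sq (hp : 5 < p) {i : K} (hi : i ^ 2 = -1) : 1 + i ≠ 0 := fun h =>
  two_ne_zero_of_charP (K := K) hp (by linear_combination (1 - i) * h + hi)

variable (K p) in
/-- The sum of `C(4k, 2k) / m ^ k` over `0 ≤ k ≤ p / 4`. -/
def quarterSum (m : K) : K :=
  ∑ k ∈ Finset.range (p / 4 + 1), (Nat.choose (4 * k) (2 * k) : K) / m ^ k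

theorem two_mul_quarterSum_neg_four (hp : 5 < p) {n : ℕ} (hpn : p = 2 * n + 1) {i : K}
    (hi : i ^ 2 = -1) :
    2 * quarterSum K p (-4) = (1 + 2 * i) ^ n + (1 - 2 * i) ^ n := by
  have h2 := two_ne_zero_of_charP (K := K) hp
  refine two_mul_sum_choose_div_pow hpn ?_ (by linear_combination -16 * hi)
  rw [show (-4 : K) = -(2 * 2) by norm_num]
  exact neg_ne_zero.mpr (mul_ne_zero h2 h2)

theorem two_mul_quarterSum_neg_sixtyFour (hp : 5 < p) {n : ℕ} (hpn : p = 2 * n + 1) {i : K}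
    (hi : i ^ 2 = -1) :
    2 * quarterSum K p (-64) = (1 + i / 2) ^ n + (1 + -i / 2) ^ n := by
  have h2 := two_ne_zero_of_charP (K := K) hp
  rw [neg_div, ← sub_eq_add_neg]
  refine two_mul_sum_choose_div_pow hpn ?_ ?_
  · rw [show (-64 : K) = -(2 ^ 6) by norm_num]
    exact neg_ne_zero.mpr (pow_ne_zero 6 h2)
  · rw [div_pow, hi]
    field_simp
    norm_num

variable [Fact p.Prime]

theorem two_pow_two_mul_eq_one (hp : 5 < p) {n : ℕ} (hpn : p = 2 * n + 1) :
    (2 : K) ^ (2 * n) = 1 := by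
  have h : frobenius K p 2 = 2 := map_ofNat _ 2
  rw [frobenius_def] at h
  apply mul_right_cancel₀ (two_ne_zero_of_charP (K := K) hp)
  rw [← pow_succ, ← hpn, h, one_mul]

theorem one_add_two_mul_pow (hp : 5 < p) {n : ℕ} (hpn : p = 2 * n + 1) {i s : K}
    (hi : i ^ 2 = -1) (hs : s ^ 2 = 5) :
    (1 + 2 * i) ^ n * ((1 + s) / 2) ^ n * (1 + 2 * i + s) = 1 + 2 * i ^ p + s ^ p := by
  have h2 := two_ne_zero_of_charP (K := K) hp
  have hF : (1 + 2 * i + s) ^ p = 1 + 2 * i ^ p + s ^ p := by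
    have : frobenius K p (1 + 2 * i + s) = 1 + 2 * frobenius K p i + frobenius K p s := by
      rw [map_add, map_add, map_mul, map_one, map_ofNat]
    simpa [frobenius_def] using this
  rw [← hF, ← mul_pow, hpn, pow_succ _ (2 * n), pow_mul _ 2 n, show (1 + 2 * i + s) ^ 2 =
    2 ^ 2 * ((1 + 2 * i) * ((1 + s) / 2)) by field_simp; linear_combination 4 * hi + hs]
  rw [mul_pow (2 ^ 2) _ n, ← pow_mul, two_pow_two_mul_eq_one hp hpn,
    one_mul]

/-- The Frobenius action on `ζ - ζ⁻¹`, where `ζ` is a primitive fifth root of unity. -/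
theorem half_one_add_pow_mul (hp : 5 < p) {n : ℕ} (hpn : p = 2 * n + 1) {s z : K}
    (hz : 1 + z + z ^ 2 + z ^ 3 + z ^ 4 = 0) (hs : s = 2 * (z + z ^ 4) + 1) :
    ((1 + s) / 2) ^ n * (-s) ^ n * (z - z ^ 4) = z ^ p - z ^ (4 * p) := by
  have h2 := two_ne_zero_of_charP (K := K) hp
  have hF : (z - z ^ 4) ^ p = z ^ p - z ^ (4 * p) := by
    have : frobenius K p (z - z ^ 4) = frobenius K p z - (frobenius K p z) ^ 4 := by simp
    rw [mul_comm 4 p, pow_mul]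
    simpa [frobenius_def] using this
  rw [← hF, ← mul_pow, hpn, pow_succ _ (2 * n), pow_mul _ 2 n, show (z - z ^ 4) ^ 2 = (1 + s) / 2 * (-s) by
    rw [hs]; field_simp; linear_combination (6 * z ^ 4 - 6 * z ^ 3 + 4 * z + 2) * hz]

/-- Values of `(1 + 2 * i) ^ n` when the Frobenius fixes `i` and `s`. -/
theorem one_add_two_mul_pow_of_fixed (hp : 5 < p) {n m : ℕ} (hpn : p = 2 * n + 1)
    (hnm : n = 2 * m) {i s c : K} (hi : i ^ 2 = -1) (hs : s ^ 2 = 5) (hip : i ^ p = i)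
    (hsp : s ^ p = s) (hc : c ^ 2 = 1) (h : ((1 + s) / 2) ^ n * (-s) ^ n = c) :
    (1 + 2 * i) ^ n = c * 5 ^ m := by
  have hw := one_add_two_mul_pow hp hpn hi hs
  rw [hip, hsp] at hw
  have h1 := mul_right_cancel₀ (one_add_two_mul_add_ne_zero hp hi hs) (hw.trans (one_mul _).symm)
  have hs' : (-s) ^ n = 5 ^ m := by rw [hnm, pow_mul, neg_sq, hs]
  rw [hs'] at h
  linear_combination (-(1 + 2 * i) ^ n) * hc - (1 + 2 * i) ^ n * c * h + c * 5 ^ m * h1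

theorem neg_pow_two_mul_add_one {s : K} (hs : s ^ 2 = 5) (m : ℕ) :
    (-s) ^ (2 * m + 1) = -s * 5 ^ m := by
  rw [pow_succ, pow_mul, neg_sq, hs, mul_comm]

/-- Values of `(1 + 2 * i) ^ n` when the Frobenius fixes `s` and negates `i`. -/
theorem one_add_two_mul_pow_of_neg_of_fixed (hp : 5 < p) {n m : ℕ} (hpn : p = 2 * n + 1)
    (hnm : n = 2 * m + 1) {i s c : K} (hi : i ^ 2 = -1) (hs : s ^ 2 = 5) (hip : i ^ p = -i)
    (hsp : s ^ p = s) (hc : c ^ 2 = 1) (h : ((1 + s) / 2) ^ n * (-s) ^ n = c) :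
    (1 + 2 * i) ^ n = -(1 - 2 * i) * c * 5 ^ m := by
  have hw := one_add_two_mul_pow hp hpn hi hs
  rw [hip, hsp] at hw
  have h1 : (1 + 2 * i) ^ n * ((1 + s) / 2) ^ n * s = 1 - 2 * i := by
    apply mul_right_cancel₀ (one_add_two_mul_add_ne_zero hp hi hs)
    linear_combination s * hw + hs + 4 * hi
  have hs' : (-s) ^ n = -s * 5 ^ m := by rw [hnm, neg_pow_two_mul_add_one hs]
  rw [hs'] at h
  linear_combination (-(1 + 2 * i) ^ n) * hc - (1 + 2 * i) ^ n * c * h - c * 5 ^ m * h1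

/-- Values of `(1 + 2 * i) ^ n` when the Frobenius negates both `i` and `s`. -/
theorem one_add_two_mul_pow_of_neg_of_neg (hp : 5 < p) {n m : ℕ} (hpn : p = 2 * n + 1)
    (hnm : n = 2 * m + 1) {i s c : K} (hi : i ^ 2 = -1) (hs : s ^ 2 = 5) (hip : i ^ p = -i)
    (hsp : s ^ p = -s) (hc : c ^ 2 = 1)
    (h : ((1 + s) / 2) ^ n * (-s) ^ n * ((1 + s) / 2) = c) :
    (1 + 2 * i) ^ n = (2 + i) * c * 5 ^ m := by
  have h2 := two_ne_zero_of_charP (K := K) hp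
  have hw := one_add_two_mul_pow hp hpn hi hs
  rw [hip, hsp] at hw
  have h1 : (1 + 2 * i) ^ n * ((1 + s) / 2) ^ n * s * ((1 + s) / 2) = -(2 + i) := by
    apply mul_right_cancel₀ (one_add_two_mul_add_ne_zero hp hi hs)
    apply mul_left_cancel₀ h2
    have h3 : 2 * ((1 + s) / 2) = 1 + s := mul_div_cancel₀ _ h2
    linear_combination s * (1 + s) * hw + s * (1 + 2 * i) ^ n * ((1 + s) / 2) ^ n *
      (1 + 2 * i + s) * h3 + (-s - 2 * i) * hs + 4 * hi
  have hs' : (-s) ^ n = -s * 5 ^ m := by rw [hnm, neg_pow_two_mul_add_one hs]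
  rw [hs'] at h
  linear_combination (-(1 + 2 * i) ^ n) * hc - (1 + 2 * i) ^ n * c * h - c * 5 ^ m * h1

/-- If the Frobenius fixes `i` and negates `s`, then `(1 + 2 * i) ^ n` and `(1 - 2 * i) ^ n`
cancel. -/
theorem one_add_two_mul_pow_add_eq_zero (hp : 5 < p) {n : ℕ} (hpn : p = 2 * n + 1)
    {i s : K} (hi : i ^ 2 = -1) (hs : s ^ 2 = 5) (hip : i ^ p = i) (hsp : s ^ p = -s) :
    (1 + 2 * i) ^ n + (1 - 2 * i) ^ n = 0 := by
  have hi' : (-i) ^ 2 = -1 := by rw [neg_sq, hi]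
  have hip' : (-i) ^ p = -i := by rw [Odd.neg_pow ⟨n, hpn⟩, hip]
  have hw := one_add_two_mul_pow hp hpn hi hs
  have hw' := one_add_two_mul_pow hp hpn hi' hs
  rw [hip, hsp] at hw
  rw [hip', hsp, show 1 + 2 * -i = 1 - 2 * i by ring] at hw'
  have hn := one_add_two_mul_add_ne_zero hp hi hs
  have hn' := one_add_two_mul_add_ne_zero hp hi' hs
  apply mul_right_cancel₀ (pow_ne_zero n (half_one_add_ne_zero hp hs))
  apply mul_right_cancel₀ hn
  apply mul_right_cancel₀ hn'
  linear_combination (1 - 2 * i + s) * hw + (1 + 2 * i + s) * hw' - 2 * hs - 8 * hi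

theorem one_add_half_pow_mul (hp : 5 < p) {n : ℕ} (hpn : p = 2 * n + 1) {i : K}
    (hi : i ^ 2 = -1) : (1 + i / 2) ^ n * (1 + i) = (1 + i ^ p) * (1 - 2 * i) ^ n := by
  have h2 := two_ne_zero_of_charP (K := K) hp
  have hF : (1 + i) ^ p = 1 + i ^ p := by rw [add_pow_char, one_pow]
  have h1 : 2 ^ 2 * (1 + i / 2) = (1 + i) ^ 2 * (1 - 2 * i) := by
    field_simp
    linear_combination (2 * i + 3) * hi
  have h3 := congrArg (· ^ n) h1
  simp only [mul_pow, ← pow_mul] at h3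
  rw [two_pow_two_mul_eq_one hp hpn, one_mul] at h3
  rw [h3, ← hF, hpn, pow_succ _ (2 * n)]
  ring

/-- If the Frobenius fixes `i`, then `(1 + i / 2) ^ n` is the conjugate of `(1 + 2 * i) ^ n`. -/
theorem one_add_half_pow_of_fixed (hp : 5 < p) {n : ℕ} (hpn : p = 2 * n + 1) {i : K}
    (hi : i ^ 2 = -1) (hip : i ^ p = i) : (1 + i / 2) ^ n = (1 - 2 * i) ^ n := by
  have h := one_add_half_pow_mul hp hpn hi
  rw [hip] at h
  apply mul_right_cancel₀ (one_add_ne_zero_of_sq hp hi)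
  rw [h, mul_comm]

theorem one_add_half_pow_of_neg (hp : 5 < p) {n : ℕ} (hpn : p = 2 * n + 1) {i : K}
    (hi : i ^ 2 = -1) (hip : i ^ p = -i) : (1 + i / 2) ^ n = -i * (1 - 2 * i) ^ n := by
  have h := one_add_half_pow_mul hp hpn hi
  rw [hip] at h
  apply mul_right_cancel₀ (one_add_ne_zero_of_sq hp hi)
  rw [h]
  linear_combination (1 - 2 * i) ^ n * hi

theorem quarterSum_neg_sixtyFour_of_fixed (hp : 5 < p) {n : ℕ} (hpn : p = 2 * n + 1) {i : K}
    (hi : i ^ 2 = -1) (hip : i ^ p = i) : quarterSum K p (-64) = quarterSum K p (-4) := by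
  apply mul_left_cancel₀ (two_ne_zero_of_charP (K := K) hp)
  rw [two_mul_quarterSum_neg_sixtyFour hp hpn hi, two_mul_quarterSum_neg_four hp hpn hi,
    one_add_half_pow_of_fixed hp hpn hi hip, one_add_half_pow_of_fixed hp hpn
      (by rw [neg_sq, hi]) (by rw [Odd.neg_pow ⟨n, hpn⟩, hip])]
  ring

theorem two_mul_quarterSum_neg_sixtyFour_of_neg (hp : 5 < p) {n : ℕ} (hpn : p = 2 * n + 1) {i : K}
    (hi : i ^ 2 = -1) (hip : i ^ p = -i) :
    2 * quarterSum K p (-64) = i * ((1 + 2 * i) ^ n - (1 - 2 * i) ^ n) := by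
  rw [two_mul_quarterSum_neg_sixtyFour hp hpn hi, one_add_half_pow_of_neg hp hpn hi hip,
    one_add_half_pow_of_neg hp hpn (by rw [neg_sq, hi]) (by rw [Odd.neg_pow ⟨n, hpn⟩, hip])]
  ring

theorem quarterSum_of_fixed (hp : 5 < p) {n m : ℕ} (hpn : p = 2 * n + 1)
    (hnm : n = 2 * m) {i s c : K} (hi : i ^ 2 = -1) (hs : s ^ 2 = 5) (hip : i ^ p = i)
    (hsp : s ^ p = s) (hc : c ^ 2 = 1) (h : ((1 + s) / 2) ^ n * (-s) ^ n = c) :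
    quarterSum K p (-64) = c * 5 ^ m ∧ quarterSum K p (-4) = c * 5 ^ m := by
  have hU := one_add_two_mul_pow_of_fixed hp hpn hnm hi hs hip hsp hc h
  have hV := one_add_two_mul_pow_of_fixed hp hpn hnm (i := -i) (by rw [neg_sq, hi]) hs
    (by rw [Odd.neg_pow ⟨n, hpn⟩, hip]) hsp hc h
  rw [mul_neg, ← sub_eq_add_neg] at hV
  rw [quarterSum_neg_sixtyFour_of_fixed hp hpn hi hip, and_self]
  apply mul_left_cancel₀ (two_ne_zero_of_charP (K := K) hp)
  rw [two_mul_quarterSum_neg_four hp hpn hi]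
  linear_combination hU + hV

theorem quarterSum_of_neg_of_fixed (hp : 5 < p) {n m : ℕ} (hpn : p = 2 * n + 1)
    (hnm : n = 2 * m + 1) {i s c : K} (hi : i ^ 2 = -1) (hs : s ^ 2 = 5) (hip : i ^ p = -i)
    (hsp : s ^ p = s) (hc : c ^ 2 = 1) (h : ((1 + s) / 2) ^ n * (-s) ^ n = c) :
    quarterSum K p (-64) = -2 * c * 5 ^ m ∧ quarterSum K p (-4) = -c * 5 ^ m := by
  have hU := one_add_two_mul_pow_of_neg_of_fixed hp hpn hnm hi hs hip hsp hc h
  have hV := one_add_two_mul_pow_of_neg_of_fixed hp hpn hnm (i := -i) (by rw [neg_sq, hi]) hs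
    (by rw [Odd.neg_pow ⟨n, hpn⟩, hip]) hsp hc h
  rw [show 1 + 2 * -i = 1 - 2 * i by ring] at hV
  have h2 := two_ne_zero_of_charP (K := K) hp
  constructor <;> apply mul_left_cancel₀ h2
  · rw [two_mul_quarterSum_neg_sixtyFour_of_neg hp hpn hi hip]
    linear_combination i * hU - i * hV + 4 * c * 5 ^ m * hi
  · rw [two_mul_quarterSum_neg_four hp hpn hi]
    linear_combination hU + hV

theorem quarterSum_of_neg_of_neg (hp : 5 < p) {n m : ℕ} (hpn : p = 2 * n + 1)
    (hnm : n = 2 * m + 1) {i s c : K} (hi : i ^ 2 = -1) (hs : s ^ 2 = 5) (hip : i ^ p = -i)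
    (hsp : s ^ p = -s) (hc : c ^ 2 = 1)
    (h : ((1 + s) / 2) ^ n * (-s) ^ n * ((1 + s) / 2) = c) :
    quarterSum K p (-64) = -c * 5 ^ m ∧ quarterSum K p (-4) = 2 * c * 5 ^ m := by
  have hU := one_add_two_mul_pow_of_neg_of_neg hp hpn hnm hi hs hip hsp hc h
  have hV := one_add_two_mul_pow_of_neg_of_neg hp hpn hnm (i := -i) (by rw [neg_sq, hi]) hs
    (by rw [Odd.neg_pow ⟨n, hpn⟩, hip]) hsp hc h
  rw [show 1 + 2 * -i = 1 - 2 * i by ring] at hV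
  have h2 := two_ne_zero_of_charP (K := K) hp
  constructor <;> apply mul_left_cancel₀ h2
  · rw [two_mul_quarterSum_neg_sixtyFour_of_neg hp hpn hi hip]
    linear_combination i * hU - i * hV + 2 * c * 5 ^ m * hi
  · rw [two_mul_quarterSum_neg_four hp hpn hi]
    linear_combination hU + hV

theorem quarterSum_of_fixed_of_neg (hp : 5 < p) {n : ℕ} (hpn : p = 2 * n + 1) {i s : K}
    (hi : i ^ 2 = -1) (hs : s ^ 2 = 5) (hip : i ^ p = i) (hsp : s ^ p = -s) :
    quarterSum K p (-64) = 0 ∧ quarterSum K p (-4) = 0 := by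
  rw [quarterSum_neg_sixtyFour_of_fixed hp hpn hi hip, and_self]
  apply mul_left_cancel₀ (two_ne_zero_of_charP (K := K) hp)
  rw [two_mul_quarterSum_neg_four hp hpn hi, mul_zero]
  exact one_add_two_mul_pow_add_eq_zero hp hpn hi hs hip hsp

/-- The evaluation of both sums in an algebraically closed field of characteristic `p`. -/
theorem quarterSum_eq [IsAlgClosed K] (hp : 5 < p) :
    (p % 20 = 1 ∨ p % 20 = 9 →
      quarterSum K p (-64) = (-1) ^ ((p + 5) / 10) * 5 ^ (p / 4) ∧
      quarterSum K p (-4) = (-1) ^ ((p + 5) / 10) * 5 ^ (p / 4)) ∧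
    (p % 20 = 3 ∨ p % 20 = 7 →
      quarterSum K p (-64) = (-1) ^ ((p + 5) / 10) * 5 ^ (p / 4) ∧
      quarterSum K p (-4) = -2 * (-1) ^ ((p + 5) / 10) * 5 ^ (p / 4)) ∧
    (p % 20 = 11 ∨ p % 20 = 19 →
      quarterSum K p (-64) = 2 * (-1) ^ ((p + 5) / 10) * 5 ^ (p / 4) ∧
      quarterSum K p (-4) = (-1) ^ ((p + 5) / 10) * 5 ^ (p / 4)) ∧
    (p % 20 = 13 ∨ p % 20 = 17 →
      quarterSum K p (-64) = 0 ∧ quarterSum K p (-4) = 0) := by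
  have h2 := two_ne_zero_of_charP (K := K) hp
  have h5 := five_ne_zero_of_charP (K := K) hp
  obtain ⟨i, hi⟩ := IsAlgClosed.exists_pow_nat_eq (-1 : K) (n := 2) (by norm_num)
  obtain ⟨z, hz⟩ : ∃ z : K, 1 + z + z ^ 2 + z ^ 3 + z ^ 4 = 0 := by
    have hdeg : (1 + .X + .X ^ 2 + .X ^ 3 + .X ^ 4 : Polynomial K).degree = 4 := by
      compute_degree!
    obtain ⟨z, hz⟩ := IsAlgClosed.exists_root _ (by rw [hdeg]; norm_num)
    exact ⟨z, by simpa using hz⟩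
  obtain ⟨s, hs⟩ : ∃ s, s = 2 * (z + z ^ 4) + 1 := ⟨_, rfl⟩
  have hs5 : s ^ 2 = 5 := by
    rw [hs]
    linear_combination (4 * z ^ 4 - 4 * z ^ 3 + 8 * z - 4) * hz
  have hi4 : i ^ 4 = 1 := by linear_combination (i ^ 2 - 1) * hi
  have hz5 : z ^ 5 = 1 := by linear_combination (z - 1) * hz
  have hip := pow_eq_pow_mod p hi4
  have hzp := pow_eq_pow_mod p hz5
  have hz4p := pow_eq_pow_mod (4 * p) hz5
  have hsp : s ^ p = 2 * (z ^ p + z ^ (4 * p)) + 1 := by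
    have : frobenius K p s = 2 * (frobenius K p z + (frobenius K p z) ^ 4) + 1 := by
      rw [hs, map_add, map_mul, map_add, map_pow, map_one, map_ofNat]
    rw [mul_comm 4 p, pow_mul]
    simpa [frobenius_def] using this
  have hθ : z - z ^ 4 ≠ 0 := by
    intro h
    have h1 : 5 * (1 + s) = 0 := by
      have : (1 + s) * s = 0 := by
        rw [hs]
        linear_combination (-2 * (z - z ^ 4)) * h + (6 * z ^ 4 - 6 * z ^ 3 + 4 * z + 2) * hz
      linear_combination s * this - (1 + s) * hs5
    exact mul_ne_zero h5 (div_ne_zero_iff.mp (half_one_add_ne_zero hp hs5)).1 h1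
  have hφ : (1 + s) / 2 = 1 + z + z ^ 4 := by
    rw [hs]
    field_simp
    ring
  have hθ' : (z ^ 2 - z ^ 3) * ((1 + s) / 2) = z - z ^ 4 := by
    rw [hφ]
    linear_combination (-z ^ 3 + 2 * z ^ 2 - z) * hz
  have hs' : 2 * (z ^ 2 + z ^ 3) + 1 = -s := by
    rw [hs]
    linear_combination 2 * hz
  have hpn : p = 2 * (p / 2) + 1 := by
    have := (Fact.out : p.Prime).eq_two_or_odd
    omega
  have hF := half_one_add_pow_mul hp hpn hz hs
  have sign_even (h : (p + 5) / 10 % 2 = 0) : (-1 : K) ^ ((p + 5) / 10) = 1 :=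
    Even.neg_one_pow (Nat.even_iff.mpr h)
  have sign_odd (h : (p + 5) / 10 % 2 = 1) : (-1 : K) ^ ((p + 5) / 10) = -1 :=
    Odd.neg_one_pow (Nat.odd_iff.mpr h)
  have i_fixed (h : p % 4 = 1) : i ^ p = i := by rw [hip, h, pow_one]
  have i_neg (h : p % 4 = 3) : i ^ p = -i := by
    rw [hip, h]
    linear_combination i * hi
  have z_pow {a : ℕ} (h : p % 5 = a) : z ^ p = z ^ a := by rw [hzp, h]
  have z_pow_four {a : ℕ} (h : 4 * p % 5 = a) : z ^ (4 * p) = z ^ a := by rw [hz4p, h]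
  refine ⟨?_, ?_, ?_, ?_⟩ <;> rintro (h | h)
  · rw [z_pow (a := 1) (by omega), z_pow_four (a := 4) (by omega)] at hF hsp
    rw [sign_even (by omega)]
    refine quarterSum_of_fixed hp hpn (by omega) hi hs5 (i_fixed (by omega))
      (by rw [hsp, hs, pow_one]) (by norm_num) (mul_right_cancel₀ hθ ?_)
    rw [hF]
    ring
  · rw [z_pow (a := 4) (by omega), z_pow_four (a := 1) (by omega)] at hF hsp
    rw [sign_odd (by omega)]
    refine quarterSum_of_fixed hp hpn (by omega) hi hs5 (i_fixed (by omega))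
      (by rw [hsp, hs, pow_one, add_comm z]) (by norm_num) (mul_right_cancel₀ hθ ?_)
    rw [hF]
    ring
  · rw [z_pow (a := 3) (by omega), z_pow_four (a := 2) (by omega)] at hF hsp
    rw [sign_even (by omega)]
    have := quarterSum_of_neg_of_neg hp hpn (m := p / 4) (c := -1) (by omega) hi hs5
      (i_neg (by omega)) (by rw [hsp, ← hs', add_comm (z ^ 3)]) (by norm_num)
      (mul_right_cancel₀ hθ (by linear_combination (1 + s) / 2 * hF - hθ'))
    simpa using this
  · rw [z_pow (a := 2) (by omega), z_pow_four (a := 3) (by omega)] at hF hsp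
    rw [sign_odd (by omega)]
    have := quarterSum_of_neg_of_neg hp hpn (m := p / 4) (c := 1) (by omega) hi hs5
      (i_neg (by omega)) (by rw [hsp, hs']) (by norm_num)
      (mul_right_cancel₀ hθ (by linear_combination (1 + s) / 2 * hF + hθ'))
    simpa using this
  · rw [z_pow (a := 1) (by omega), z_pow_four (a := 4) (by omega)] at hF hsp
    rw [sign_odd (by omega)]
    have := quarterSum_of_neg_of_fixed hp hpn (m := p / 4) (c := 1) (by omega) hi hs5
      (i_neg (by omega)) (by rw [hsp, hs, pow_one]) (by norm_num)
      (mul_right_cancel₀ hθ (by linear_combination hF))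
    simpa using this
  · rw [z_pow (a := 4) (by omega), z_pow_four (a := 1) (by omega)] at hF hsp
    rw [sign_even (by omega)]
    have := quarterSum_of_neg_of_fixed hp hpn (m := p / 4) (c := -1) (by omega) hi hs5
      (i_neg (by omega)) (by rw [hsp, hs, pow_one, add_comm z]) (by norm_num)
      (mul_right_cancel₀ hθ (by linear_combination hF))
    simpa using this
  · rw [z_pow (a := 3) (by omega), z_pow_four (a := 2) (by omega)] at hsp
    exact quarterSum_of_fixed_of_neg hp hpn hi hs5 (i_fixed (by omega))
      (by rw [hsp, ← hs', add_comm (z ^ 3)])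
  · rw [z_pow (a := 2) (by omega), z_pow_four (a := 3) (by omega)] at hsp
    exact quarterSum_of_fixed_of_neg hp hpn hi hs5 (i_fixed (by omega)) (by rw [hsp, hs'])

end


theorem stmt5 (p : ℕ) [Fact p.Prime] (hp : 5 < p) :
    ((p % 20 = 1 ∨ p % 20 = 3 ∨ p % 20 = 7 ∨ p % 20 = 9 →
      (∑ k ∈ Finset.range (p / 4 + 1),
          (Nat.choose (4 * k) (2 * k) : ZMod p) / (-64 : ZMod p) ^ k)
        = (-1 : ZMod p) ^ ((p + 5) / 10) * 5 ^ (p / 4)) ∧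
    (p % 20 = 11 ∨ p % 20 = 19 →
      (∑ k ∈ Finset.range (p / 4 + 1),
          (Nat.choose (4 * k) (2 * k) : ZMod p) / (-64 : ZMod p) ^ k)
        = 2 * (-1 : ZMod p) ^ ((p + 5) / 10) * 5 ^ ((p - 3) / 4)) ∧
    (p % 20 = 13 ∨ p % 20 = 17 →
      (∑ k ∈ Finset.range (p / 4 + 1),
          (Nat.choose (4 * k) (2 * k) : ZMod p) / (-64 : ZMod p) ^ k) = 0)) ∧
    ((p % 20 = 1 ∨ p % 20 = 9 ∨ p % 20 = 11 ∨ p % 20 = 19 →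
      (∑ k ∈ Finset.range (p / 4 + 1),
          (Nat.choose (4 * k) (2 * k) : ZMod p) / (-4 : ZMod p) ^ k)
        = (-1 : ZMod p) ^ ((p + 5) / 10) * 5 ^ (p / 4)) ∧
    (p % 20 = 3 ∨ p % 20 = 7 →
      (∑ k ∈ Finset.range (p / 4 + 1),
          (Nat.choose (4 * k) (2 * k) : ZMod p) / (-4 : ZMod p) ^ k)
        = -2 * (-1 : ZMod p) ^ ((p + 5) / 10) * 5 ^ ((p - 3) / 4)) ∧
    (p % 20 = 13 ∨ p % 20 = 17 →
      (∑ k ∈ Finset.range (p / 4 + 1),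
          (Nat.choose (4 * k) (2 * k) : ZMod p) / (-4 : ZMod p) ^ k) = 0)) := by
  let φ := algebraMap (ZMod p) (AlgebraicClosure (ZMod p))
  have : CharP (AlgebraicClosure (ZMod p)) p :=
    charP_of_injective_algebraMap φ.injective p
  have hmap (m : ZMod p) : φ (∑ k ∈ Finset.range (p / 4 + 1),
      (Nat.choose (4 * k) (2 * k) : ZMod p) / m ^ k) =
      quarterSum (AlgebraicClosure (ZMod p)) p (φ m) := by
    simp [quarterSum]
  obtain ⟨h₁, h₂, h₃, h₄⟩ := quarterSum_eq (K := AlgebraicClosure (ZMod p)) hp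
  have h64 := hmap (-64)
  have h4 := hmap (-4)
  rw [map_neg, map_ofNat] at h64 h4
  refine ⟨⟨fun h => ?_, fun h => ?_, fun h => ?_⟩, ⟨fun h => ?_, fun h => ?_, fun h => ?_⟩⟩ <;>
    apply φ.injective
  · rw [h64]
    simp only [map_mul, map_pow, map_neg, map_one, map_ofNat]
    rcases h with h | h | h | h
    exacts [(h₁ (.inl h)).1, (h₂ (.inl h)).1, (h₂ (.inr h)).1, (h₁ (.inr h)).1]
  · rw [h64, show (p - 3) / 4 = p / 4 by omega]
    simp only [map_mul, map_pow, map_neg, map_one, map_ofNat]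
    exact (h₃ h).1
  · rw [h64, map_zero]
    exact (h₄ h).1
  · rw [h4]
    simp only [map_mul, map_pow, map_neg, map_one, map_ofNat]
    rcases h with h | h | h | h
    exacts [(h₁ (.inl h)).2, (h₁ (.inr h)).2, (h₃ (.inl h)).2, (h₃ (.inr h)).2]
  · rw [h4, show (p - 3) / 4 = p / 4 by omega]
    simp only [map_mul, map_pow, map_neg, map_one, map_ofNat]
    exact (h₂ h).2
  · rw [h4, map_zero]
    exact (h₄ h).2
end
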